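/- arXiv:1402.5586 — 4 statements merged into one kernel-verified Lean document; each statement's English description precedes it below -/
import Mathlib

section
/- Let n be a positive natural number, H_b an invertible real 3×3 matrix, H_bm a real 3×n matrix with H_bm·H_bmᵀ invertible and right pseudoinverse H_bm⁺ = H_bmᵀ(H_bm·H_bmᵀ)⁻¹, p₀ ∈ ℝ³, λ ∈ ℝ, Δε ∈ ℝ³, ζ ∈ ℝⁿ, and ω ∈ ℝ³, φ̇ ∈ ℝⁿ. If the angular-momentum conservation relation H_b·ω + H_bm·φ̇ = p₀ holds and φ̇ equals the control law with exactly known parameters, φ̇ = (Iₙ − H_bm⁺·H_bm)·ζ + H_bm⁺·(p₀ + λ·H_b·Δε), then ω + λ·Δε = 0; i.e., with exact parameters the control law enforces the sliding variable s_b = ω + λ·Δε to vanish identically. -/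
open Matrix

/-- With exactly known parameters, the control law enforces the sliding
variable `s_b = ω + λ Δε` to vanish. -/
theorem exact_parameters_sliding_variable_vanishes
    (n : ℕ) (hn : 0 < n)
    (Hb : Matrix (Fin 3) (Fin 3) ℝ) (hHb : IsUnit Hb)
    (Hbm : Matrix (Fin 3) (Fin n) ℝ)
    (hHbm : IsUnit (Hbm * Hbmᵀ))
    (p₀ : Fin 3 → ℝ) (lam : ℝ) (Δε : Fin 3 → ℝ)
    (ζ : Fin n → ℝ) (ω : Fin 3 → ℝ) (φdot : Fin n → ℝ)
    (hmom : Hb.mulVec ω + Hbm.mulVec φdot = p₀)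
    (hctrl : φdot = ((1 : Matrix (Fin n) (Fin n) ℝ)
          - (Hbmᵀ * (Hbm * Hbmᵀ)⁻¹) * Hbm).mulVec ζ
        + (Hbmᵀ * (Hbm * Hbmᵀ)⁻¹).mulVec (p₀ + lam • Hb.mulVec Δε)) :
    ω + lam • Δε = 0 := by
  have hright : Hbm * (Hbmᵀ * (Hbm * Hbmᵀ)⁻¹) = 1 := by
    rw [← Matrix.mul_assoc]
    exact Matrix.mul_nonsing_inv _ ((Matrix.isUnit_iff_isUnit_det _).mp hHbm)
  have hcoupled : Hbm.mulVec φdot = p₀ + lam • Hb.mulVec Δε := by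
    rw [hctrl, Matrix.mulVec_add, Matrix.mulVec_mulVec, Matrix.mulVec_mulVec, Matrix.mul_sub,
      ← Matrix.mul_assoc Hbm _ Hbm, hright, Matrix.mul_one, Matrix.one_mul, sub_self,
      Matrix.zero_mulVec, zero_add, Matrix.one_mulVec]
  apply Matrix.mulVec_injective_of_isUnit hHb
  rw [Matrix.mulVec_add, Matrix.mulVec_smul, Matrix.mulVec_zero]
  rw [hcoupled, add_left_comm] at hmom
  exact add_eq_left.mp hmom
end

section
/- Let n, m be positive natural numbers. Let Ĥ_bm be a real 3×n matrix with Ĥ_bm·Ĥ_bmᵀ invertible and right pseudoinverse Ĥ_bm⁺ = Ĥ_bmᵀ(Ĥ_bm·Ĥ_bmᵀ)⁻¹, and set T̂ = Iₙ − Ĥ_bm⁺·Ĥ_bm. Let Ĵ_m be a real m×n matrix such that (Ĵ_m·T̂)·(Ĵ_m·T̂)ᵀ is invertible, with right pseudoinverse (Ĵ_m·T̂)⁺. Let u ∈ ℝ³ and w ∈ ℝ^m be arbitrary, let ζ = (Ĵ_m·T̂)⁺·(w − Ĵ_m·Ĥ_bm⁺·u), and define φ̇* = T̂·ζ + Ĥ_bm⁺·u.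 Then simultaneously Ĥ_bm·φ̇* = u and Ĵ_m·φ̇* = w. (Applied with u = p̂₀ + λ_b·Ĥ_b·Δε_bv and w = ẋ_d − Λ_x·Δx − v̂₀, this shows the combined control law (24) enforces both the spacecraft-attitude relation (11) and the end-effector relation (25).) -/
open Matrix

/-- The right pseudoinverse `Aᵀ (A Aᵀ)⁻¹` is a right inverse of `A` when `A Aᵀ` is invertible. -/
theorem mul_transpose_mul_inv_of_isUnit {m n R : Type*} [Fintype m] [DecidableEq m] [Fintype n]
    [CommRing R] {A : Matrix m n R} (hA : IsUnit (A * Aᵀ)) :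
    A * (Aᵀ * (A * Aᵀ)⁻¹) = 1 := by
  rw [← Matrix.mul_assoc, Matrix.mul_nonsing_inv _ ((Matrix.isUnit_iff_isUnit_det _).mp hA)]

/-- The combined control law enforces both the spacecraft-attitude relation
`Ĥ_bm φ̇* = u` and the end-effector relation `Ĵ_m φ̇* = w`. -/
theorem combined_control_law
    (n m : ℕ) (hn : 0 < n) (hm : 0 < m)
    (Hbmhat : Matrix (Fin 3) (Fin n) ℝ)
    (hH : IsUnit (Hbmhat * Hbmhatᵀ))
    (Jmhat : Matrix (Fin m) (Fin n) ℝ)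
    (u : Fin 3 → ℝ) (w : Fin m → ℝ) :
    let Hplus : Matrix (Fin n) (Fin 3) ℝ := Hbmhatᵀ * (Hbmhat * Hbmhatᵀ)⁻¹
    let T : Matrix (Fin n) (Fin n) ℝ := 1 - Hplus * Hbmhat
    let JT : Matrix (Fin m) (Fin n) ℝ := Jmhat * T
    ∀ _hJT : IsUnit (JT * JTᵀ),
    let JTplus : Matrix (Fin n) (Fin m) ℝ := JTᵀ * (JT * JTᵀ)⁻¹
    let ζ : Fin n → ℝ := JTplus.mulVec (w - (Jmhat * Hplus).mulVec u)
    let φdotstar : Fin n → ℝ := T.mulVec ζ + Hplus.mulVec u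
    Hbmhat.mulVec φdotstar = u ∧ Jmhat.mulVec φdotstar = w := by
  intro Hplus T JT hJT JTplus ζ φdotstar
  have hHplus : Hbmhat * Hplus = 1 := mul_transpose_mul_inv_of_isUnit hH
  have hJTplus : Jmhat * T * JTplus = 1 := mul_transpose_mul_inv_of_isUnit hJT
  have hHT : Hbmhat * T = 0 := by
    simp only [T, Matrix.mul_sub, Matrix.mul_one, ← Matrix.mul_assoc, hHplus, Matrix.one_mul,
      sub_self]
  constructor
  · simp only [φdotstar, mulVec_add, mulVec_mulVec, hHT, hHplus, zero_mulVec, one_mulVec, zero_add]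
  · simp only [φdotstar, ζ, mulVec_add, mulVec_mulVec, ← Matrix.mul_assoc, hJTplus, one_mulVec,
      sub_add_cancel]
end

section
/- Let k be a positive natural number and let f : ℝ → ℝᵏ be uniformly continuous on [0,∞) and square integrable on [0,∞), i.e. ∫₀^∞ ‖f(t)‖² dt < ∞. Then f(t) → 0 as t → ∞. -/
open Filter MeasureTheory

/-- A function that is uniformly continuous on `[a, ∞)` and whose squared norm is integrable there
tends to zero at infinity. -/
theorem UniformContinuousOn.tendsto_zero_of_integrableOn_norm_sq
    {E : Type*} [NormedAddCommGroup E] {f : ℝ → E} {a : ℝ}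
    (hf : UniformContinuousOn f (Set.Ici a))
    (hint : IntegrableOn (fun t => ‖f t‖ ^ 2) (Set.Ici a)) :
    Tendsto f atTop (nhds 0) := by
  rw [Metric.tendsto_nhds]
  intro ε hε
  obtain ⟨δ, hδ, hclose⟩ := Metric.uniformContinuousOn_iff.mp hf (ε / 2) (half_pos hε)
  have htail : Tendsto (fun t : ℝ => ∫ x in Set.Ioi t, ‖f x‖ ^ 2) atTop (nhds 0) :=
    tendsto_integral_Ioi_zero tendsto_id
  have hpos : 0 < (ε / 2) ^ 2 * (δ / 2) := by positivity
  filter_upwards [htail.eventually_lt_const hpos, eventually_ge_atTop a] with t ht hat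
  rw [dist_zero_right]
  by_contra! hε_le
  have hlower : ∀ x ∈ Set.Ioc t (t + δ / 2), (ε / 2) ^ 2 ≤ ‖f x‖ ^ 2 := by
    intro x hx
    have hdist : dist t x < δ := by
      rw [Real.dist_eq, abs_lt]
      constructor <;> linarith [hx.1, hx.2]
    have hfx := hclose t hat x (hat.trans hx.1.le) hdist
    rw [dist_eq_norm] at hfx
    gcongr
    linarith [norm_sub_norm_le (f t) (f x)]
  have hintt : IntegrableOn (fun x => ‖f x‖ ^ 2) (Set.Ioi t) :=
    hint.mono_set (Set.Ioi_subset_Ici hat)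
  have hwindow := setIntegral_ge_of_const_le_real measurableSet_Ioc
    measure_Ioc_lt_top.ne hlower (hintt.mono_set Set.Ioc_subset_Ioi_self)
  rw [Real.volume_real_Ioc_of_le (by linarith), add_sub_cancel_left] at hwindow
  have hmono : ∫ x in Set.Ioc t (t + δ / 2), ‖f x‖ ^ 2 ≤ ∫ x in Set.Ioi t, ‖f x‖ ^ 2 :=
    setIntegral_mono_set hintt (ae_of_all _ fun x => sq_nonneg ‖f x‖)
      Set.Ioc_subset_Ioi_self.eventuallyLE
  linarith

/-- Barbalat-type lemma: a uniformly continuous, square-integrable function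
on `[0, ∞)` tends to zero at infinity. -/
theorem square_integrable_uniformly_continuous_tendsto_zero
    (k : ℕ) (hk : 0 < k)
    (f : ℝ → EuclideanSpace ℝ (Fin k))
    (hf_uc : UniformContinuousOn f (Set.Ici 0))
    (hf_L2 : (∫⁻ t in Set.Ici (0:ℝ), ENNReal.ofReal (‖f t‖ ^ 2)) < ⊤) :
    Tendsto f atTop (nhds 0) := by
  refine hf_uc.tendsto_zero_of_integrableOn_norm_sq ⟨?_, ?_⟩
  · exact (hf_uc.continuousOn.norm.pow 2).aestronglyMeasurable measurableSet_Ici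
  · rwa [hasFiniteIntegral_iff_ofReal (ae_of_all _ fun t => sq_nonneg ‖f t‖)]
end

section
/- Let m be a positive natural number, Λ a symmetric positive definite real m×m matrix, and x : ℝ → ℝ^m a differentiable function. Define the sliding variable s(t) = x'(t) + Λ·x(t). If s(t) → 0 as t → ∞, then x(t) → 0 and x'(t) → 0 as t → ∞. (This is the property of the sliding variable s_x = Δẋ + Λ_x·Δx used to conclude end-effector tracking: s_x → 0 implies Δx → 0 and Δẋ → 0.) -/
open Matrix Filter

/-- A linear endomorphism of a finite-dimensional real inner product space whose quadratic form is
positive away from zero is coercive. -/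
theorem exists_pos_mul_norm_sq_le_inner {E : Type*} [NormedAddCommGroup E] [InnerProductSpace ℝ E]
    [FiniteDimensional ℝ E] (A : E →ₗ[ℝ] E) (hA : ∀ v : E, v ≠ 0 → 0 < inner ℝ v (A v)) :
    ∃ c : ℝ, 0 < c ∧ ∀ v : E, c * ‖v‖ ^ 2 ≤ inner ℝ v (A v) := by
  have : ProperSpace E := FiniteDimensional.proper_real E
  have hcont : Continuous fun v : E => inner ℝ v (A v) :=
    continuous_id.inner A.continuous_of_finiteDimensional
  obtain ⟨c, hc, hcle⟩ := (isCompact_sphere (0 : E) 1).exists_forall_le' hcont.continuousOn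
    (a := 0) fun v hv => hA v (ne_zero_of_mem_unit_sphere ⟨v, hv⟩)
  refine ⟨c, hc, fun v => ?_⟩
  rcases eq_or_ne v 0 with rfl | hv
  · simp
  have hv' : 0 < ‖v‖ := norm_pos_iff.mpr hv
  have hunit : c ≤ inner ℝ (‖v‖⁻¹ • v) (A (‖v‖⁻¹ • v)) :=
    hcle _ (by simp [norm_smul, hv'.ne'])
  rw [map_smul, real_inner_smul_left, real_inner_smul_right] at hunit
  calc c * ‖v‖ ^ 2 ≤ ‖v‖⁻¹ * (‖v‖⁻¹ * inner ℝ v (A v)) * ‖v‖ ^ 2 := by gcongr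
    _ = inner ℝ v (A v) := by field_simp

/-- A nonnegative solution of the differential inequality `V' + c V ≤ b` with `c > 0` tends to zero
when `b` does. -/
theorem tendsto_zero_of_deriv_add_mul_le {V V' b : ℝ → ℝ} {c : ℝ} (hc : 0 < c)
    (hV : ∀ t, HasDerivAt V (V' t) t) (hV0 : ∀ t, 0 ≤ V t) (hle : ∀ t, V' t + c * V t ≤ b t)
    (hb : Tendsto b atTop (nhds 0)) : Tendsto V atTop (nhds 0) := by
  refine tendsto_order.2 ⟨fun a ha => .of_forall fun t => ha.trans_le (hV0 t), fun ε hε => ?_⟩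
  have hδ : 0 < c * (ε / 2) := by positivity
  obtain ⟨T, hT⟩ := eventually_atTop.1 (hb.eventually_le_const hδ)
  have hderiv : ∀ t, HasDerivAt (fun t => Real.exp (c * t) * (V t - ε / 2))
      (Real.exp (c * t) * (V' t + c * V t - c * (ε / 2))) t := fun t => by
    have hexp : HasDerivAt (fun t => Real.exp (c * t)) (Real.exp (c * t) * (c * 1)) t :=
      ((hasDerivAt_id t).const_mul c).exp
    exact (hexp.mul ((hV t).sub_const (ε / 2))).congr_deriv (by ring)
  have hanti : AntitoneOn (fun t => Real.exp (c * t) * (V t - ε / 2)) (Set.Ici T) := by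
    refine antitoneOn_of_deriv_nonpos (convex_Ici T)
      (fun t _ => (hderiv t).continuousAt.continuousWithinAt)
      (fun t _ => (hderiv t).differentiableAt.differentiableWithinAt) fun t ht => ?_
    rw [interior_Ici, Set.mem_Ioi] at ht
    rw [(hderiv t).deriv]
    exact mul_nonpos_of_nonneg_of_nonpos (Real.exp_nonneg _)
      (by linarith [hle t, hT t ht.le])
  have hgrow : Tendsto (fun t => Real.exp (c * t) * (ε / 2)) atTop atTop :=
    (Real.tendsto_exp_atTop.comp (tendsto_id.const_mul_atTop hc)).atTop_mul_const (half_pos hε)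
  filter_upwards [eventually_ge_atTop T,
    hgrow.eventually_gt_atTop (Real.exp (c * T) * (V T - ε / 2))] with t ht hlt
  have hVt := (hanti Set.self_mem_Ici ht ht).trans_lt hlt
  linarith [lt_of_mul_lt_mul_left hVt (Real.exp_nonneg _)]

/-- If `A` is coercive and `x' + A x` tends to zero, then so does `x`. -/
theorem tendsto_zero_of_deriv_add_coercive {E : Type*} [NormedAddCommGroup E]
    [InnerProductSpace ℝ E] {A : E → E} {c : ℝ} (hc : 0 < c)
    (hA : ∀ v : E, c * ‖v‖ ^ 2 ≤ inner ℝ v (A v)) {x : ℝ → E} (hx : Differentiable ℝ x)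
    (hs : Tendsto (fun t => deriv x t + A (x t)) atTop (nhds 0)) :
    Tendsto x atTop (nhds 0) := by
  have hb : Tendsto (fun t => ‖deriv x t + A (x t)‖ ^ 2 / c) atTop (nhds 0) := by
    simpa using (hs.norm.pow 2).div_const c
  have hsq : Tendsto (fun t => ‖x t‖ ^ 2) atTop (nhds 0) := by
    refine tendsto_zero_of_deriv_add_mul_le hc (fun t => (hx t).hasDerivAt.norm_sq)
      (fun t => sq_nonneg _) (fun t => ?_) hb
    have hcs := real_inner_le_norm (x t) (deriv x t + A (x t))
    rw [inner_add_right] at hcs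
    rw [le_div_iff₀ hc]
    nlinarith [hA (x t), sq_nonneg (c * ‖x t‖ - ‖deriv x t + A (x t)‖)]
  rw [tendsto_zero_iff_norm_tendsto_zero]
  simpa using hsq.sqrt

/-- If the sliding variable `s = x' + Λ x` tends to zero (with `Λ` symmetric
positive definite), then both `x` and `x'` tend to zero. -/
theorem sliding_variable_convergence
    (m : ℕ) (hm : 0 < m)
    (Λ : Matrix (Fin m) (Fin m) ℝ) (hΛ : Λ.PosDef)
    (x : ℝ → EuclideanSpace ℝ (Fin m)) (hx : Differentiable ℝ x)
    (s : ℝ → EuclideanSpace ℝ (Fin m))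
    (hs : ∀ t : ℝ, s t = deriv x t + Matrix.toEuclideanLin Λ (x t))
    (hs0 : Tendsto s atTop (nhds 0)) :
    Tendsto x atTop (nhds 0) ∧ Tendsto (deriv x) atTop (nhds 0) := by
  have hpos : ∀ v : EuclideanSpace ℝ (Fin m), v ≠ 0 → 0 < inner ℝ v (toEuclideanLin Λ v) := by
    intro v hv
    have hdot := hΛ.dotProduct_mulVec_pos (x := v.ofLp) (by simpa using hv)
    rw [EuclideanSpace.inner_eq_star_dotProduct, dotProduct_comm]
    simpa using hdot
  obtain ⟨c, hc, hcoer⟩ := exists_pos_mul_norm_sq_le_inner (toEuclideanLin Λ) hpos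
  have hx0 : Tendsto x atTop (nhds 0) :=
    tendsto_zero_of_deriv_add_coercive hc hcoer hx (by simpa only [← hs] using hs0)
  have hΛx : Tendsto (fun t => toEuclideanLin Λ (x t)) atTop (nhds 0) := by
    simpa [Function.comp_def] using ((toEuclideanLin Λ).continuous_of_finiteDimensional.tendsto 0).comp hx0
  exact ⟨hx0, by simpa [hs] using hs0.sub hΛx⟩
end
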